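/- Assume (T1) α|μ| > |1−αδ|, (T2) μ² > 4(1−αδ), (T3) μ > 0. Then for every ε > 0 and every real z < 0, the reflection coefficient satisfies |s(z)|² ≤ 1. -/

import Mathlib

open Complex Real Filter Set MeasureTheory ComplexConjugate Topology

noncomputable section

/-- The inverse hyperbolic tangent. -/
def arctanh (x : ℝ) : ℝ := Real.log ((1 + x) / (1 - x)) / 2

/-- The hyperbolic secant. -/
def sech (x : ℝ) : ℝ := 1 / Real.cosh x

/-- The point `z_P = (1-αδ+αμ)/4`. -/
def zP (α δ μ : ℝ) : ℝ := (1 - α*δ + α*μ)/4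

/-- The point `z_∞ = (1-αδ-αμ)/4`. -/
def zInf (α δ μ : ℝ) : ℝ := (1 - α*δ - α*μ)/4

/-- The discriminant `α⁴ + α²μ²/4 − α²(1−αδ)`. -/
def discrm (α δ μ : ℝ) : ℝ := α^4 + α^2*μ^2/4 - α^2*(1 - α*δ)

/-- The point `z⁺`. -/
def zplus (α δ μ : ℝ) : ℝ := (1/2)*((1 - α*δ)/2 - α^2 + Real.sqrt (discrm α δ μ))

/-- The point `z⁻ = z_L`. -/
def zminus (α δ μ : ℝ) : ℝ := (1/2)*((1 - α*δ)/2 - α^2 - Real.sqrt (discrm α δ μ))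

/-- `Ω(z) = (2/(iα))(z − (1−αδ)/4)`. -/
def Omg (α δ : ℝ) (z : ℂ) : ℂ := (2 / (Complex.I * α)) * (z - (1 - α * δ) / 4)

/-- `R(z) = e^{iπ/4}(−i(16z−μ²))^{1/2}` (principal branch). -/
def Rf (μ : ℝ) (z : ℂ) : ℂ :=
  Complex.exp (Complex.I * (π : ℂ) / 4) * (-Complex.I * (16 * z - (μ:ℂ)^2)) ^ ((1:ℂ)/2)

/-- The reflection coefficient `s(z)` (Gamma-function formula). -/
def sRef (α δ μ ε : ℝ) (z : ℂ) : ℂ :=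
  -(((2:ℂ) ^ (-(Complex.I * (μ:ℂ)) / (ε:ℂ)) * Complex.I * (ε:ℂ)) /
      (2 * Complex.exp (Complex.I * (π : ℂ) / 4) * (-Complex.I * z) ^ ((1:ℂ)/2))) *
    (Complex.Gamma (1/2 - Complex.I * (μ:ℂ) / (2*ε) - Omg α δ z / ε) /
      Complex.Gamma (1/2 + Complex.I * (μ:ℂ) / (2*ε) + Omg α δ z / ε)) *
    ((Complex.Gamma (1/2 + Omg α δ z / ε - Rf μ z / (2*ε)) *
      Complex.Gamma (1/2 + Omg α δ z / ε + Rf μ z / (2*ε))) /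
      (Complex.Gamma (-(Complex.I * (μ:ℂ)) / (2*ε) - Rf μ z / (2*ε)) *
        Complex.Gamma (-(Complex.I * (μ:ℂ)) / (2*ε) + Rf μ z / (2*ε))))

theorem norm_Gamma_half_add_sq (y : ℝ) :
    ‖Complex.Gamma (1 / 2 + y * Complex.I)‖ ^ 2 = π / Real.cosh (π * y) := by
  have hconj : (1 : ℂ) - (1 / 2 + y * Complex.I) = conj (1 / 2 + y * Complex.I) := by
    apply Complex.ext <;> simp
    norm_num
  have h := Complex.Gamma_mul_Gamma_one_sub (1 / 2 + y * Complex.I)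
  have hsin : Complex.sin (π * (1 / 2 + y * Complex.I)) = (Real.cosh (π * y) : ℝ) := by
    rw [show (π : ℂ) * (1 / 2 + y * Complex.I) = (π * y : ℂ) * Complex.I + π / 2 by ring,
      Complex.sin_add_pi_div_two, Complex.cos_mul_I]
    push_cast
    rfl
  rw [hconj, Complex.Gamma_conj, Complex.mul_conj, Complex.normSq_eq_norm_sq, hsin] at h
  exact_mod_cast h

theorem norm_Gamma_mul_I_sq (y : ℝ) (hy : y ≠ 0) :
    ‖Complex.Gamma (y * Complex.I)‖ ^ 2 = π / (y * Real.sinh (π * y)) := by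
  have h := Complex.Gamma_mul_Gamma_one_sub (y * Complex.I)
  have hne : -((y : ℂ) * Complex.I) ≠ 0 := by simpa using hy
  have hconj : -((y : ℂ) * Complex.I) = conj (y * Complex.I) := by simp
  have hs : Complex.sinh (π * y) ≠ 0 := by
    exact_mod_cast Real.sinh_ne_zero.mpr (mul_ne_zero Real.pi_ne_zero hy)
  rw [show (1 : ℂ) - y * Complex.I = -(y * Complex.I) + 1 by ring,
    Complex.Gamma_add_one _ hne, ← mul_assoc, mul_comm (Complex.Gamma _) (-_), mul_assoc,
    hconj, Complex.Gamma_conj, Complex.mul_conj, Complex.normSq_eq_norm_sq, ← hconj,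
    ← mul_assoc, Complex.sin_mul_I] at h
  have hy' : (y : ℂ) ≠ 0 := by exact_mod_cast hy
  have key : ((‖Complex.Gamma (y * Complex.I)‖ ^ 2 : ℝ) : ℂ)
      = ((π / (y * Real.sinh (π * y)) : ℝ) : ℂ) := by
    push_cast at h ⊢
    rw [eq_div_iff (mul_ne_zero hs Complex.I_ne_zero)] at h
    rw [eq_div_iff (mul_ne_zero hy' hs)]
    linear_combination h + (‖Complex.Gamma (y * Complex.I)‖ : ℂ) ^ 2 * y * Complex.sinh (π * y)
      * Complex.I_mul_I
  exact_mod_cast key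

theorem norm_Gamma_half_sub_I (y : ℝ) :
    ‖Complex.Gamma (1 / 2 - y * Complex.I)‖ = ‖Complex.Gamma (1 / 2 + y * Complex.I)‖ := by
  rw [show (1 / 2 - y * Complex.I : ℂ) = conj (1 / 2 + y * Complex.I) by
    apply Complex.ext <;> simp,
    Complex.Gamma_conj, Complex.norm_conj]

theorem Omg_ofReal (α δ z : ℝ) (hα : α ≠ 0) :
    Omg α δ z = ((1 - α * δ - 4 * z) / (2 * α) : ℝ) * Complex.I := by
  have : (α : ℂ) ≠ 0 := by exact_mod_cast hα
  rw [Omg]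
  push_cast
  field_simp
  linear_combination (-4 * (1 - α * δ - 4 * z : ℂ)) * Complex.I_mul_I

theorem Rf_sq (μ : ℝ) (z : ℂ) : Rf μ z ^ 2 = 16 * z - (μ : ℂ) ^ 2 := by
  have h1 : Complex.exp (Complex.I * (π : ℂ) / 4) ^ 2 = Complex.I := by
    rw [← Complex.exp_nat_mul,
      show ((2 : ℕ) : ℂ) * (Complex.I * π / 4) = π / 2 * Complex.I by push_cast; ring,
      Complex.exp_pi_div_two_mul_I]
  have h2 : ∀ w : ℂ, (w ^ ((1 : ℂ) / 2)) ^ 2 = w := fun w => by simp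
  rw [Rf, mul_pow, h1, h2]
  linear_combination (-(16 * z - (μ : ℂ) ^ 2)) * Complex.I_mul_I

theorem Rf_eq_or_eq_neg (μ z : ℝ) (h : 16 * z ≤ μ ^ 2) :
    Rf μ z = (√(μ ^ 2 - 16 * z) : ℝ) * Complex.I ∨
      Rf μ z = -((√(μ ^ 2 - 16 * z) : ℝ) * Complex.I) := by
  rw [← sq_eq_sq_iff_eq_or_eq_neg, Rf_sq, mul_pow, ← Complex.ofReal_pow (√_),
    Real.sq_sqrt (by linarith), Complex.I_sq]
  push_cast
  ring

theorem norm_two_cpow_mul_I (t : ℝ) : ‖(2 : ℂ) ^ ((t : ℂ) * Complex.I)‖ = 1 := by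
  simpa using Complex.norm_cpow_eq_rpow_re_of_pos (x := 2) two_pos ((t : ℂ) * Complex.I)

theorem norm_cpow_half_sq (w : ℂ) : ‖w ^ ((1 : ℂ) / 2)‖ ^ 2 = ‖w‖ := by
  rw [← norm_pow]
  simp

theorem norm_sRef_sq (α δ μ ε z ω r : ℝ) (hε : 0 < ε) (hz : z < 0)
    (hω : Omg α δ z = ω * Complex.I) (hr : r ^ 2 = μ ^ 2 - 16 * z)
    (hR : Rf μ z = r * Complex.I ∨ Rf μ z = -(r * Complex.I)) :
    ‖sRef α δ μ ε z‖ ^ 2 =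
      Real.sinh (π * ((r + μ) / (2 * ε))) * Real.sinh (π * ((r - μ) / (2 * ε))) /
        (Real.cosh (π * ((2 * ω - r) / (2 * ε))) * Real.cosh (π * ((2 * ω + r) / (2 * ε)))) := by
  have hεC : (ε : ℂ) ≠ 0 := by exact_mod_cast hε.ne'
  have hpm : (r + μ) * (r - μ) ≠ 0 := by nlinarith
  have hp : r + μ ≠ 0 := left_ne_zero_of_mul hpm
  have hm : r - μ ≠ 0 := right_ne_zero_of_mul hpm
  have e1 : -(Complex.I * (μ : ℂ)) / ε = ((-μ / ε : ℝ) : ℂ) * Complex.I := by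
    push_cast; ring
  have e2 : (1 / 2 : ℂ) - Complex.I * μ / (2 * ε) - ω * Complex.I / ε =
      1 / 2 - ((μ + 2 * ω) / (2 * ε) : ℝ) * Complex.I := by
    push_cast; field_simp; ring
  have e3 : (1 / 2 : ℂ) + Complex.I * μ / (2 * ε) + ω * Complex.I / ε =
      1 / 2 + ((μ + 2 * ω) / (2 * ε) : ℝ) * Complex.I := by
    push_cast; field_simp; ring
  have e4 : (1 / 2 : ℂ) + ω * Complex.I / ε - r * Complex.I / (2 * ε) =
      1 / 2 + ((2 * ω - r) / (2 * ε) : ℝ) * Complex.I := by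
    push_cast; field_simp; ring
  have e5 : (1 / 2 : ℂ) + ω * Complex.I / ε + r * Complex.I / (2 * ε) =
      1 / 2 + ((2 * ω + r) / (2 * ε) : ℝ) * Complex.I := by
    push_cast; field_simp; ring
  have e6 : -(Complex.I * (μ : ℂ)) / (2 * ε) - r * Complex.I / (2 * ε) =
      (-((r + μ) / (2 * ε)) : ℝ) * Complex.I := by
    push_cast; field_simp; ring
  have e7 : -(Complex.I * (μ : ℂ)) / (2 * ε) + r * Complex.I / (2 * ε) =
      ((r - μ) / (2 * ε) : ℝ) * Complex.I := by
    push_cast; field_simp; ring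
  have hp' : (r + μ) / (2 * ε) ≠ 0 := by positivity
  have hm' : (r - μ) / (2 * ε) ≠ 0 := by positivity
  have hs1 := Real.sinh_ne_zero.mpr (mul_ne_zero Real.pi_ne_zero hp')
  have hs2 := Real.sinh_ne_zero.mpr (mul_ne_zero Real.pi_ne_zero hm')
  have hexp : ‖Complex.exp (Complex.I * (π : ℂ) / 4)‖ = 1 := by
    rw [show Complex.I * (π : ℂ) / 4 = (π / 4 : ℝ) * Complex.I by push_cast; ring,
      Complex.norm_exp_ofReal_mul_I]
  have hphase : ‖Complex.Gamma (1 / 2 + ((μ + 2 * ω) / (2 * ε) : ℝ) * Complex.I)‖ ^ 2 ≠ 0 := by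
    rw [norm_Gamma_half_add_sq]
    positivity
  have hzn : ‖-Complex.I * (z : ℂ)‖ = -z := by simp [abs_of_neg hz]
  have hG : ‖sRef α δ μ ε z‖ ^ 2 = ε ^ 2 / (4 * -z) *
      ((‖Complex.Gamma (1 / 2 + ((2 * ω - r) / (2 * ε) : ℝ) * Complex.I)‖ ^ 2 *
        ‖Complex.Gamma (1 / 2 + ((2 * ω + r) / (2 * ε) : ℝ) * Complex.I)‖ ^ 2) /
      (‖Complex.Gamma ((-((r + μ) / (2 * ε)) : ℝ) * Complex.I)‖ ^ 2 *
        ‖Complex.Gamma (((r - μ) / (2 * ε) : ℝ) * Complex.I)‖ ^ 2)) := by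
    have hdiv : ∀ a b : ℂ, a - -b = a + b ∧ a + -b = a - b := fun a b => ⟨by ring, by ring⟩
    rw [sRef, hω]
    rcases hR with hR | hR
    on_goal 1 => rw [hR]
    on_goal 2 => simp only [hR, neg_div _ ((r : ℂ) * Complex.I), (hdiv _ _).1, (hdiv _ _).2]
    all_goals
      rw [e1, e2, e3, e4, e5, e6, e7]
      simp only [norm_mul, norm_div, norm_neg, mul_pow, div_pow, norm_two_cpow_mul_I, hexp,
        norm_Gamma_half_sub_I, norm_cpow_half_sq, hzn, div_self hphase, Complex.norm_I,
        Complex.norm_real, Real.norm_eq_abs, sq_abs, RCLike.norm_ofNat]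
      ring
  rw [hG, norm_Gamma_half_add_sq, norm_Gamma_half_add_sq, norm_Gamma_mul_I_sq _ (neg_ne_zero.mpr hp'),
    norm_Gamma_mul_I_sq _ hm', mul_neg π, Real.sinh_neg]
  have hz' : -z = (r + μ) * (r - μ) / 16 := by linarith
  rw [hz']
  have hc1 := (Real.cosh_pos (π * ((2 * ω - r) / (2 * ε)))).ne'
  have hc2 := (Real.cosh_pos (π * ((2 * ω + r) / (2 * ε)))).ne'
  generalize Real.sinh (π * ((r + μ) / (2 * ε))) = s1 at *
  generalize Real.sinh (π * ((r - μ) / (2 * ε))) = s2 at *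
  generalize Real.cosh (π * ((2 * ω - r) / (2 * ε))) = c1 at *
  generalize Real.cosh (π * ((2 * ω + r) / (2 * ε))) = c2 at *
  field_simp
  ring

theorem sinh_mul_sinh_le_cosh_mul_cosh {a b c d : ℝ} (h : a + b = d - c) :
    Real.sinh a * Real.sinh b ≤ Real.cosh c * Real.cosh d := by
  have h1 := Real.cosh_add a b
  have h2 := Real.cosh_sub a b
  have h3 := Real.cosh_add d c
  have h4 := Real.cosh_sub d c
  rw [h] at h1
  nlinarith [Real.cosh_pos (a - b), Real.cosh_pos (d + c)]

/-- for negative real `z` the reflection coefficient satisfies `|s(z)|² ≤ 1`. -/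
theorem reflection_bound_negative (α δ μ : ℝ) (hα : 0 < α)
    (hT1 : α * |μ| > |1 - α*δ|) (hT2 : μ^2 > 4*(1 - α*δ)) (hT3 : 0 < μ) :
    ∀ ε : ℝ, 0 < ε → ∀ z : ℝ, z < 0 →
      ‖sRef α δ μ ε (z:ℂ)‖^2 ≤ 1 := by
  intro ε hε z hz
  have hneg : 0 ≤ μ ^ 2 - 16 * z := by nlinarith
  rw [norm_sRef_sq α δ μ ε z _ (√(μ ^ 2 - 16 * z)) hε hz (Omg_ofReal α δ z hα.ne')
    (Real.sq_sqrt hneg) (Rf_eq_or_eq_neg μ z (by linarith))]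
  refine div_le_one_of_le₀ (sinh_mul_sinh_le_cosh_mul_cosh (by ring)) (by positivity)
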